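/- Let S ⊂ ℝ^d be a nonempty compact convex set with diameter D, let f : ℝ^d → ℝ have L-Lipschitz gradient on S with G := sup_{x∈S} ‖∇f(x)‖ < ∞, let C ≥ max{L D², G D}, f* := inf_{x∈S} f(x), and suppose each g_δ(x^k) satisfies |⟨∇f(x^k) − g_δ(x^k), s − x^k⟩| ≤ δ ‖∇f(x^k)‖ for all s ∈ S. With the stepsize ᾱ_k = max{G̃(x^k) − δ‖∇f(x^k)‖, 0}/C and update x^{k+1} = x^k + ᾱ_k (s^k − x^k), s^k ∈ argmin_{s∈S} ⟨g_δ(x^k), s − x^k⟩, it holds for every K ≥ 0 that min_{0 ≤ k ≤ K} max{G(x^k) − 2δ‖∇f(x^k)‖, 0} ≤ √(2C (f(x^0) − f*)/(K+1)), where G(x) = max_{s∈S} ⟨∇f(x), x − s⟩. -/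

import Mathlib

open RealInnerProductSpace

/-- Descent lemma along a segment of `S`. -/
theorem descent_aux {d : ℕ} (S : Set (EuclideanSpace ℝ (Fin d))) (hSconv : Convex ℝ S)
    (f : EuclideanSpace ℝ (Fin d) → ℝ) (L : ℝ)
    (hdiff : ∀ x ∈ S, DifferentiableAt ℝ f x)
    (hLip : ∀ x ∈ S, ∀ y ∈ S, ‖gradient f x - gradient f y‖ ≤ L * ‖x - y‖)
    (x s : EuclideanSpace ℝ (Fin d)) (hx : x ∈ S) (hs : s ∈ S) (a : ℝ)
    (ha0 : 0 ≤ a) (ha1 : a ≤ 1) :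
    f (x + a • (s - x)) ≤ f x + a * ⟪gradient f x, s - x⟫ + L * a ^ 2 / 2 * ‖s - x‖ ^ 2 := by
  have hmem : ∀ t ∈ Set.Icc (0 : ℝ) 1, x + t • (s - x) ∈ S := fun t ht =>
    hSconv.add_smul_sub_mem hx hs ht
  let φ : ℝ → ℝ := fun t =>
    f (x + t • (s - x)) - t * ⟪gradient f x, s - x⟫ - L * t ^ 2 / 2 * ‖s - x‖ ^ 2
  have hd : ∀ t ∈ Set.Icc (0 : ℝ) 1, HasDerivAt φ
      (⟪gradient f (x + t • (s - x)), s - x⟫ - ⟪gradient f x, s - x⟫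
        - L * t * ‖s - x‖ ^ 2) t := by
    intro t ht
    have h1 : HasDerivAt (fun t : ℝ => x + t • (s - x)) (s - x) t := by
      simpa using ((hasDerivAt_id t).smul_const (s - x)).const_add x
    have h2 := (hdiff _ (hmem t ht)).hasGradientAt.hasFDerivAt.comp_hasDerivAt t h1
    have h3 : HasDerivAt (fun t : ℝ => t * ⟪gradient f x, s - x⟫)
        ⟪gradient f x, s - x⟫ t := by
      simpa using (hasDerivAt_id t).mul_const ⟪gradient f x, s - x⟫
    have h4 : HasDerivAt (fun t : ℝ => L * t ^ 2 / 2 * ‖s - x‖ ^ 2)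
        (L * t * ‖s - x‖ ^ 2) t := by
      have := (((hasDerivAt_pow 2 t).const_mul L).div_const 2).mul_const (‖s - x‖ ^ 2)
      refine this.congr_deriv ?_
      rw [show (2 - 1 : ℕ) = 1 from rfl, pow_one]
      push_cast
      ring
    have h5 := (h2.sub h3).sub h4
    exact h5
  have hanti : AntitoneOn φ (Set.Icc (0 : ℝ) 1) := by
    refine antitoneOn_of_deriv_nonpos (convex_Icc 0 1)
      (fun t ht => (hd t ht).continuousAt.continuousWithinAt) ?_ ?_
    · intro t ht
      exact (hd t (interior_subset ht)).differentiableAt.differentiableWithinAt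
    · intro t ht
      have ht' := interior_subset ht
      rw [(hd t ht').deriv, ← inner_sub_left]
      have h1 := real_inner_le_norm (gradient f (x + t • (s - x)) - gradient f x) (s - x)
      have h2 := hLip _ (hmem t ht') x hx
      rw [add_sub_cancel_left, norm_smul, Real.norm_of_nonneg ht'.1] at h2
      have h3 := mul_le_mul_of_nonneg_right h2 (norm_nonneg (s - x))
      nlinarith
  have := hanti (Set.left_mem_Icc.2 zero_le_one) ⟨ha0, ha1⟩ ha0
  simp only [φ] at this
  rw [zero_smul, add_zero] at this
  linarith

/-- Theorem 4.2 (relative oracle: residual scales with `‖∇f‖`): along the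
Frank–Wolfe iterates driven by a directionally relative δ-oracle,
`min_{0≤k≤K} (G(x^k) - 2δ‖∇f(x^k)‖)₊ ≤ √(2C (f(x⁰) - f*)/(K+1))`. -/
theorem relative_delta_oracle_rate {d : ℕ}
    (S : Set (EuclideanSpace ℝ (Fin d)))
    (hSne : S.Nonempty) (hScomp : IsCompact S) (hSconv : Convex ℝ S)
    (f : EuclideanSpace ℝ (Fin d) → ℝ) (L C δ : ℝ)
    (hdiff : ∀ x ∈ S, DifferentiableAt ℝ f x)
    (hLip : ∀ x ∈ S, ∀ y ∈ S, ‖gradient f x - gradient f y‖ ≤ L * ‖x - y‖)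
    (hC : C ≥ max (L * (Metric.diam S) ^ 2)
      (sSup ((fun x => ‖gradient f x‖) '' S) * Metric.diam S))
    (x s g : ℕ → EuclideanSpace ℝ (Fin d))
    (hx0 : x 0 ∈ S)
    (horacle : ∀ k, ∀ t ∈ S,
      |⟪gradient f (x k) - g k, t - x k⟫| ≤ δ * ‖gradient f (x k)‖)
    (hsS : ∀ k, s k ∈ S)
    (hmin : ∀ k, ∀ t ∈ S, ⟪g k, s k - x k⟫ ≤ ⟪g k, t - x k⟫)
    (hupd : ∀ k, x (k + 1) = x k +
      (max (⟪g k, x k - s k⟫ - δ * ‖gradient f (x k)‖) 0 / C) • (s k - x k)) :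
    ∀ K : ℕ, ∃ k ≤ K,
      max (sSup ((fun t => ⟪gradient f (x k), x k - t⟫) '' S)
          - 2 * δ * ‖gradient f (x k)‖) 0 ≤
        Real.sqrt (2 * C * (f (x 0) - sInf (f '' S)) / (K + 1)) := by
  set D := Metric.diam S with hD
  set M := sSup ((fun x => ‖gradient f x‖) '' S) with hM
  set p : ℕ → ℝ := fun k => max (⟪g k, x k - s k⟫ - δ * ‖gradient f (x k)‖) 0 with hp
  have hD0 : 0 ≤ D := Metric.diam_nonneg
  have hdist : ∀ y ∈ S, ∀ z ∈ S, ‖y - z‖ ≤ D := by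
    intro y hy z hz
    rw [← dist_eq_norm]
    exact Metric.dist_le_diam_of_mem hScomp.isBounded hy hz
  have hM0 : 0 ≤ M := Real.sSup_nonneg (by rintro _ ⟨y, _, rfl⟩; exact norm_nonneg _)
  have hbdd : BddAbove ((fun x => ‖gradient f x‖) '' S) := by
    refine ⟨‖gradient f (x 0)‖ + |L| * D, ?_⟩
    rintro _ ⟨y, hy, rfl⟩
    have h1 := hLip y hy _ hx0
    have h2 := norm_le_norm_add_norm_sub' (gradient f y) (gradient f (x 0))
    have h3 : L * ‖y - x 0‖ ≤ |L| * D :=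
      mul_le_mul (le_abs_self L) (hdist y hy _ hx0) (norm_nonneg _) (abs_nonneg _)
    simp only
    linarith
  have hMle : ∀ y ∈ S, ‖gradient f y‖ ≤ M := fun y hy => le_csSup hbdd ⟨y, hy, rfl⟩
  have hCL : L * D ^ 2 ≤ C := le_trans (le_max_left _ _) hC
  have hCM : M * D ≤ C := le_trans (le_max_right _ _) hC
  have hC0 : 0 ≤ C := le_trans (mul_nonneg hM0 hD0) hCM
  have hp0 : ∀ k, 0 ≤ p k := fun k => le_max_right _ _
  -- relation between exact and approximate directional derivative
  have horc : ∀ k, ∀ t ∈ S, |⟪gradient f (x k), x k - t⟫ - ⟪g k, x k - t⟫|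
      ≤ δ * ‖gradient f (x k)‖ := by
    intro k t ht
    have h := horacle k t ht
    rw [← inner_sub_left, ← neg_sub t (x k), inner_neg_right, abs_neg]
    exact h
  have hpC : ∀ k, x k ∈ S → p k ≤ C := by
    intro k hk
    refine max_le ?_ hC0
    have h1 := (abs_le.1 (horc k _ (hsS k))).1
    have h2 := real_inner_le_norm (gradient f (x k)) (x k - s k)
    have h3 : ‖gradient f (x k)‖ * ‖x k - s k‖ ≤ M * D :=
      mul_le_mul (hMle _ hk) (hdist _ hk _ (hsS k)) (norm_nonneg _) hM0
    linarith
  have hxS : ∀ k, x k ∈ S := by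
    intro k
    induction k with
    | zero => exact hx0
    | succ k ih =>
      rw [hupd k]
      exact hSconv.add_smul_sub_mem ih (hsS k)
        ⟨div_nonneg (hp0 k) hC0, div_le_one_of_le₀ (hpC k ih) hC0⟩
  have hstep : ∀ k, p k ^ 2 ≤ 2 * C * (f (x k) - f (x (k + 1))) := by
    intro k
    rcases hC0.eq_or_lt with hC' | hC'
    · have h1 := hpC k (hxS k)
      have h2 := hp0 k
      have : p k = 0 := by linarith
      rw [this, ← hC']
      simp
    · set a := p k / C with ha
      have ha0 : 0 ≤ a := div_nonneg (hp0 k) hC0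
      have hdes := descent_aux S hSconv f L hdiff hLip (x k) (s k) (hxS k) (hsS k) a
        ha0 (div_le_one_of_le₀ (hpC k (hxS k)) hC0)
      have hx1 : x (k + 1) = x k + a • (s k - x k) := hupd k
      rw [← hx1] at hdes
      have hpa : p k = a * C := by rw [ha]; field_simp
      have hL : L * ‖s k - x k‖ ^ 2 ≤ C := by
        rcases le_total 0 L with h | h
        · refine le_trans (mul_le_mul_of_nonneg_left ?_ h) hCL
          exact pow_le_pow_left₀ (norm_nonneg _) (hdist _ (hsS k) _ (hxS k)) 2
        · exact le_trans (mul_nonpos_of_nonpos_of_nonneg h (sq_nonneg _)) hC0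
      have hap : a * ⟪gradient f (x k), s k - x k⟫ ≤ - (a * p k) := by
        rcases le_total (⟪g k, x k - s k⟫ - δ * ‖gradient f (x k)‖) 0 with h | h
        · have : p k = 0 := max_eq_right h
          simp [ha, this]
        · have h0 : p k = ⟪g k, x k - s k⟫ - δ * ‖gradient f (x k)‖ := max_eq_left h
          have h1 := (abs_le.1 (horc k _ (hsS k))).1
          rw [← neg_sub (x k) (s k), inner_neg_right, mul_neg]
          exact neg_le_neg (mul_le_mul_of_nonneg_left (by linarith) ha0)
      have h6 : a ^ 2 / 2 * (L * ‖s k - x k‖ ^ 2) ≤ a ^ 2 / 2 * C :=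
        mul_le_mul_of_nonneg_left hL (by positivity)
      have h7 : a ^ 2 * C / 2 ≤ f (x k) - f (x (k + 1)) := by
        rw [hpa] at hap
        linarith
      have h8 := mul_le_mul_of_nonneg_left h7 (by positivity : 0 ≤ 2 * C)
      rw [hpa]
      linarith
  have hsum : ∀ n : ℕ, ∑ k ∈ Finset.range n, p k ^ 2 ≤ 2 * C * (f (x 0) - f (x n)) := by
    intro n
    induction n with
    | zero => simp
    | succ n ih =>
      rw [Finset.sum_range_succ]
      have := hstep n
      linarith
  intro K
  have hcont : ContinuousOn f S := fun y hy => (hdiff y hy).continuousAt.continuousWithinAt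
  have hinf : sInf (f '' S) ≤ f (x (K + 1)) :=
    csInf_le (hScomp.image_of_continuousOn hcont).bddBelow ⟨_, hxS _, rfl⟩
  have htot : ∑ k ∈ Finset.range (K + 1), p k ^ 2
      ≤ 2 * C * (f (x 0) - sInf (f '' S)) :=
    (hsum (K + 1)).trans (mul_le_mul_of_nonneg_left (by linarith) (by positivity))
  obtain ⟨k, hk, hkle⟩ := Finset.exists_le_of_sum_le (s := Finset.range (K + 1))
    (f := fun k => p k ^ 2)
    (g := fun _ => 2 * C * (f (x 0) - sInf (f '' S)) / ((K : ℝ) + 1))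
    ⟨0, by simp⟩ (by
      rw [Finset.sum_const, Finset.card_range, nsmul_eq_mul]
      push_cast
      rw [mul_div_cancel₀ _ (by positivity : (K : ℝ) + 1 ≠ 0)]
      exact htot)
  refine ⟨k, by simpa [Nat.lt_succ_iff] using hk, ?_⟩
  refine le_trans (max_le ?_ (hp0 k)) (Real.le_sqrt_of_sq_le hkle)
  have hG : sSup ((fun t => ⟪gradient f (x k), x k - t⟫) '' S)
      ≤ ⟪g k, x k - s k⟫ + δ * ‖gradient f (x k)‖ := by
    refine csSup_le (hSne.image _) ?_
    rintro _ ⟨t, ht, rfl⟩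
    have h1 := (abs_le.1 (horc k t ht)).2
    have h2 := hmin k t ht
    rw [← neg_sub (x k) (s k), ← neg_sub (x k) t, inner_neg_right, inner_neg_right] at h2
    simp only
    linarith
  refine le_trans ?_ (le_max_left _ _)
  linarith
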